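/- In the general case, the optimal cost decomposes over the leftmost and rightmost sensors used: OptCost = min { D(i,j) : 1 ≤ i ≤ l, r ≤ j ≤ n, j − i + 1 ≥ λ }. (This is Lemma 9 of the paper.) -/

import Mathlib

/-- A configuration `y` of the `n` sensors (with covering range `z`) covers the
barrier `[0, β]`. -/
def Covers (n : ℕ) (z β : ℝ) (y : ℕ → ℝ) : Prop :=
  Set.Icc (0 : ℝ) β ⊆ ⋃ i ∈ Finset.Icc 1 n, Set.Icc (y i - z) (y i + z)

/-- The cost of moving the sensors from positions `x` to positions `y`. -/
noncomputable def Cost (n : ℕ) (x y : ℕ → ℝ) : ℝ :=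
  ∑ i ∈ Finset.Icc 1 n, |x i - y i|

/-- The optimal (infimum) cost over all covering configurations. -/
noncomputable def OptCost (n : ℕ) (z β : ℝ) (x : ℕ → ℝ) : ℝ :=
  sInf {c : ℝ | ∃ y : ℕ → ℝ, Covers n z β y ∧ c = Cost n x y}

/-- General case: the modified positions `x^{(i,j)}` where sensors left of `l` are
moved to `-z` and sensors right of `r` are moved to `β + z`. -/
noncomputable def XMod (x : ℕ → ℝ) (l r : ℕ) (z β : ℝ) (t : ℕ) : ℝ :=
  if t < l then -z else if t ≤ r then x t else β + z

/-- General case: the optimal cost `OptC(i,j)` of the containing-case instance on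
sensors `i, …, j` with modified positions `x^{(i,j)}`. -/
noncomputable def OptCG (z β : ℝ) (x : ℕ → ℝ) (l r i j : ℕ) : ℝ :=
  sInf {c : ℝ | ∃ y : ℕ → ℝ,
    (Set.Icc (0 : ℝ) β ⊆ ⋃ t ∈ Finset.Icc i j, Set.Icc (y t - z) (y t + z)) ∧
    c = ∑ t ∈ Finset.Icc i j, |XMod x l r z β t - y t|}

/-- General case: `D(i,j)`, the cost of the manual movements plus the optimal cost of
the resulting containing-case instance on sensors `i, …, j`. -/
noncomputable def DG (z β : ℝ) (x : ℕ → ℝ) (l r i j : ℕ) : ℝ :=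
  (∑ t ∈ Finset.Icc i (l - 1), (-z - x t)) +
    (∑ t ∈ Finset.Icc (r + 1) j, (x t - z - β)) + OptCG z β x l r i j

theorem sum_Icc_split (f : ℕ → ℝ) {i l r j : ℕ} (hl : 1 ≤ l) (hil : i ≤ l) (hlr : l ≤ r)
    (hrj : r ≤ j) :
    ∑ t ∈ Finset.Icc i j, f t = ∑ t ∈ Finset.Icc i (l - 1), f t +
      ∑ t ∈ Finset.Icc l r, f t + ∑ t ∈ Finset.Icc (r + 1) j, f t := by
  have h : ∀ a b : ℕ, Finset.Icc a b = Finset.Ico a (b + 1) := fun a b => by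
    ext; simp
  simp only [h]
  rw [Nat.sub_add_cancel hl, Finset.sum_Ico_consecutive _ hil (by omega),
    Finset.sum_Ico_consecutive _ (by omega) (by omega)]

/-- Exchanging a finite index set for one of the same size with dominating values. -/
theorem sum_le_sum_of_card_eq (f : ℕ → ℝ) {S T : Finset ℕ} (hc : S.card = T.card)
    (hf : ∀ s ∈ S, s ∉ T → ∀ t ∈ T, f s ≤ f t) : ∑ s ∈ S, f s ≤ ∑ t ∈ T, f t := by
  have hc' : (S \ T).card = (T \ S).card := Finset.card_sdiff_comm hc
  let e := Finset.equivOfCardEq hc'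
  have hd : ∑ s ∈ S \ T, f s ≤ ∑ t ∈ T \ S, f t := by
    rw [← Finset.sum_coe_sort (S \ T), ← Finset.sum_coe_sort (T \ S), ← Equiv.sum_comp e]
    refine Finset.sum_le_sum fun s _ => ?_
    have h1 := Finset.mem_sdiff.1 s.2
    have h2 := Finset.mem_sdiff.1 (e s).2
    exact hf _ h1.1 h1.2 _ h2.1
  have h1 := Finset.sum_inter_add_sum_sdiff S T f
  have h2 := Finset.sum_inter_add_sum_sdiff T S f
  rw [Finset.inter_comm] at h2
  linarith

theorem exists_bijOn_of_card_eq {S T : Finset ℕ} (hc : S.card = T.card) :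
    ∃ e : ℕ → ℕ, Set.BijOn e T S :=
  Set.Finite.exists_bijOn_of_encard_eq T.finite_toSet (by simp [hc])

/-- A barrier covered by finitely many intervals of length `2 * z` is no longer than
their total length. -/
theorem le_card_mul_of_cover {z β : ℝ} (hz : 0 < z) {S : Finset ℕ} {y : ℕ → ℝ}
    (h : Set.Icc (0 : ℝ) β ⊆ ⋃ t ∈ S, Set.Icc (y t - z) (y t + z)) :
    β ≤ S.card * (2 * z) := by
  have h1 := (MeasureTheory.measure_mono (μ := MeasureTheory.volume) h).trans
    (MeasureTheory.measure_biUnion_finset_le S _)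
  have h2 : ∀ t, y t + z - (y t - z) = 2 * z := fun t => by ring
  simp only [Real.volume_Icc, h2, sub_zero, Finset.sum_const, nsmul_eq_mul] at h1
  rw [← ENNReal.ofReal_natCast, ← ENNReal.ofReal_mul (by positivity)] at h1
  exact (ENNReal.ofReal_le_ofReal_iff (by positivity)).1 h1

/-- Enough sensors can be placed side by side to cover the barrier. -/
theorem exists_cover {z β : ℝ} (hz : 0 < z) {i j : ℕ} (hij : i ≤ j)
    (h : ⌈β / (2 * z)⌉₊ ≤ j - i + 1) :
    ∃ y : ℕ → ℝ, Set.Icc (0 : ℝ) β ⊆ ⋃ t ∈ Finset.Icc i j, Set.Icc (y t - z) (y t + z) := by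
  have hlen : β ≤ (((j - i : ℕ) : ℝ) + 1) * (2 * z) := by
    have := Nat.ceil_le.1 h
    rw [div_le_iff₀ (by positivity)] at this
    exact_mod_cast this
  refine ⟨fun t => (2 * ((t : ℝ) - i) + 1) * z, fun p hp => ?_⟩
  have hp0 : 0 ≤ p / (2 * z) := div_nonneg hp.1 (by positivity)
  simp only [Set.mem_iUnion, Finset.mem_Icc, Set.mem_Icc, exists_prop]
  rcases le_total (⌊p / (2 * z)⌋₊) (j - i) with hq | hq
  · refine ⟨i + ⌊p / (2 * z)⌋₊, ⟨by omega, by omega⟩, ?_⟩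
    have h1 := Nat.floor_le hp0
    have h2 := (Nat.lt_floor_add_one (p / (2 * z))).le
    rw [le_div_iff₀ (by positivity)] at h1
    rw [div_le_iff₀ (by positivity)] at h2
    push_cast
    constructor <;> linarith
  · refine ⟨i + (j - i), ⟨by omega, by omega⟩, ?_⟩
    have h1 := (Nat.le_floor_iff hp0).1 hq
    rw [le_div_iff₀ (by positivity)] at h1
    have h2 := hp.2
    rw [Nat.cast_add]
    constructor <;> linarith

/-- A group `S` of sensors whose movements all pass through the common point `c`, at
distance `g` from their initial positions, can be replaced by an equally large group `T`
with smaller distances to `c`, without increasing the cost. -/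
theorem exists_reassignment {x y g : ℕ → ℝ} {c : ℝ} {A S T : Finset ℕ} (hSA : S ⊆ A)
    (hc : S.card = T.card) (hg : ∀ s ∈ S, s ∉ T → ∀ t ∈ T, g t ≤ g s)
    (hxy : ∀ s ∈ S, |x s - y s| = g s + |c - y s|) :
    ∃ e : ℕ → ℕ, (∀ s ∈ S, ∃ t ∈ T, e t = s) ∧
      ∑ t ∈ T, g t + ∑ t ∈ T, |c - y (e t)| ≤ ∑ s ∈ A, |x s - y s| := by
  obtain ⟨e, he⟩ := exists_bijOn_of_card_eq hc
  refine ⟨e, fun s hs => he.surjOn hs, ?_⟩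
  have h1 : ∑ t ∈ T, |c - y (e t)| = ∑ s ∈ S, |c - y s| :=
    Finset.sum_nbij e (fun t ht => he.mapsTo ht) he.injOn he.surjOn fun _ _ => rfl
  have h2 := sum_le_sum_of_card_eq (fun t => -g t) hc
    fun s hs hsT t ht => neg_le_neg (hg s hs hsT t ht)
  simp only [Finset.sum_neg_distrib] at h2
  have h3 : ∑ s ∈ S, |x s - y s| ≤ ∑ s ∈ A, |x s - y s| :=
    Finset.sum_le_sum_of_subset_of_nonneg hSA fun _ _ _ => abs_nonneg _
  rw [Finset.sum_congr rfl hxy, Finset.sum_add_distrib] at h3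
  linarith

theorem sum_XMod_split (z β : ℝ) (x y : ℕ → ℝ) {i l r j : ℕ} (hl : 1 ≤ l) (hil : i ≤ l)
    (hlr : l ≤ r) (hrj : r ≤ j) :
    ∑ t ∈ Finset.Icc i j, |XMod x l r z β t - y t| =
      ∑ t ∈ Finset.Icc i (l - 1), |-z - y t| + ∑ t ∈ Finset.Icc l r, |x t - y t| +
        ∑ t ∈ Finset.Icc (r + 1) j, |β + z - y t| := by
  rw [sum_Icc_split _ hl hil hlr hrj]
  congr 1
  · congr 1
    · refine Finset.sum_congr rfl fun t ht => ?_
      rw [Finset.mem_Icc] at ht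
      rw [XMod, if_pos (by omega)]
    · refine Finset.sum_congr rfl fun t ht => ?_
      rw [Finset.mem_Icc] at ht
      rw [XMod, if_neg (by omega), if_pos (by omega)]
  · refine Finset.sum_congr rfl fun t ht => ?_
    rw [Finset.mem_Icc] at ht
    rw [XMod, if_neg (by omega), if_neg (by omega)]

theorem bddBelow_costs (n : ℕ) (z β : ℝ) (x : ℕ → ℝ) :
    BddBelow {c : ℝ | ∃ y : ℕ → ℝ, Covers n z β y ∧ c = Cost n x y} := by
  refine ⟨0, ?_⟩
  rintro _ ⟨y, -, rfl⟩
  exact Finset.sum_nonneg fun _ _ => abs_nonneg _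

theorem OptCG_le {z β : ℝ} {x y : ℕ → ℝ} {l r i j : ℕ}
    (h : Set.Icc (0 : ℝ) β ⊆ ⋃ t ∈ Finset.Icc i j, Set.Icc (y t - z) (y t + z)) :
    OptCG z β x l r i j ≤ ∑ t ∈ Finset.Icc i j, |XMod x l r z β t - y t| := by
  refine csInf_le ⟨0, ?_⟩ ⟨y, h, rfl⟩
  rintro _ ⟨y, -, rfl⟩
  exact Finset.sum_nonneg fun _ _ => abs_nonneg _

/-- Moving sensors through the modified positions is at least as expensive as an
optimal direct movement. -/
theorem OptCost_le_DG {n : ℕ} {z β : ℝ} {x : ℕ → ℝ} {l r i j : ℕ} (hz : 0 < z)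
    (hl : 1 ≤ l) (hlr : l ≤ r) (hleft : ∀ t, 1 ≤ t → t < l → x t < -z)
    (hright : ∀ t, r < t → t ≤ n → β + z < x t)
    (hi : 1 ≤ i) (hil : i ≤ l) (hrj : r ≤ j) (hjn : j ≤ n)
    (hlen : ⌈β / (2 * z)⌉₊ ≤ j - i + 1) : OptCost n z β x ≤ DG z β x l r i j := by
  suffices h : OptCost n z β x - (∑ t ∈ Finset.Icc i (l - 1), (-z - x t)) -
      (∑ t ∈ Finset.Icc (r + 1) j, (x t - z - β)) ≤ OptCG z β x l r i j by
    rw [DG]; linarith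
  obtain ⟨y₀, hy₀⟩ := exists_cover hz (by omega : i ≤ j) hlen
  refine le_csInf ⟨_, y₀, hy₀, rfl⟩ ?_
  rintro _ ⟨y, hy, rfl⟩
  let w : ℕ → ℝ := fun t => if i ≤ t ∧ t ≤ j then y t else x t
  have hw : ∀ t ∈ Finset.Icc i j, w t = y t := fun t ht => if_pos (Finset.mem_Icc.1 ht)
  have hcov : Covers n z β w := fun p hp => by
    have hp' := hy hp
    simp only [Set.mem_iUnion, exists_prop] at hp' ⊢
    obtain ⟨t, ht, hpt⟩ := hp'
    refine ⟨t, Finset.Icc_subset_Icc hi hjn ht, ?_⟩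
    rwa [hw t ht]
  have hle : OptCost n z β x ≤ Cost n x w := csInf_le (bddBelow_costs n z β x) ⟨w, hcov, rfl⟩
  have hcost : Cost n x w = ∑ t ∈ Finset.Icc i j, |x t - y t| := by
    rw [Cost, ← Finset.sum_subset (Finset.Icc_subset_Icc hi hjn)]
    · exact Finset.sum_congr rfl fun t ht => by rw [hw t ht]
    · intro t _ ht
      rw [Finset.mem_Icc] at ht
      simp [w, ht]
  rw [sum_Icc_split _ hl hil hlr hrj] at hcost
  rw [sum_XMod_split z β x y hl hil hlr hrj]
  have hL : ∑ t ∈ Finset.Icc i (l - 1), |x t - y t| ≤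
      ∑ t ∈ Finset.Icc i (l - 1), (-z - x t) + ∑ t ∈ Finset.Icc i (l - 1), |-z - y t| := by
    rw [← Finset.sum_add_distrib]
    refine Finset.sum_le_sum fun t ht => ?_
    rw [Finset.mem_Icc] at ht
    have h1 := hleft t (by omega) (by omega)
    have h2 := abs_sub_le (x t) (-z) (y t)
    rw [abs_of_nonpos (by linarith : x t - -z ≤ 0)] at h2
    linarith
  have hR : ∑ t ∈ Finset.Icc (r + 1) j, |x t - y t| ≤
      ∑ t ∈ Finset.Icc (r + 1) j, (x t - z - β) +
        ∑ t ∈ Finset.Icc (r + 1) j, |β + z - y t| := by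
    rw [← Finset.sum_add_distrib]
    refine Finset.sum_le_sum fun t ht => ?_
    rw [Finset.mem_Icc] at ht
    have h1 := hright t (by omega) (by omega)
    have h2 := abs_sub_le (x t) (β + z) (y t)
    rw [abs_of_nonneg (by linarith : 0 ≤ x t - (β + z))] at h2
    linarith
  linarith

/-- Every covering configuration costs at least as much as some admissible choice of
leftmost and rightmost sensors. -/
theorem exists_DG_le_Cost {n : ℕ} {z β : ℝ} {x y : ℕ → ℝ} {l r : ℕ} (hz : 0 < z)
    (hl : 1 ≤ l) (hlr : l ≤ r) (hrn : r ≤ n)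
    (hmono : ∀ a b, 1 ≤ a → a ≤ b → b ≤ n → x a ≤ x b)
    (hleft : ∀ t, 1 ≤ t → t < l → x t < -z)
    (hright : ∀ t, r < t → t ≤ n → β + z < x t) (hy : Covers n z β y) :
    ∃ i j : ℕ, 1 ≤ i ∧ i ≤ l ∧ r ≤ j ∧ j ≤ n ∧ ⌈β / (2 * z)⌉₊ ≤ j - i + 1 ∧
      DG z β x l r i j ≤ Cost n x y := by
  classical
  let SL := (Finset.Icc 1 (l - 1)).filter fun t => -z ≤ y t
  let SR := (Finset.Icc (r + 1) n).filter fun t => y t ≤ β + z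
  have hSL : SL.card ≤ l - 1 := (Finset.card_filter_le _ _).trans (by simp)
  have hSR : SR.card ≤ n - r := (Finset.card_filter_le _ _).trans (by simp)
  obtain ⟨i, hi⟩ : ∃ i, i = l - SL.card := ⟨_, rfl⟩
  obtain ⟨j, hj⟩ : ∃ j, j = r + SR.card := ⟨_, rfl⟩
  have hil : i ≤ l := by omega
  have hrj : r ≤ j := by omega
  obtain ⟨eL, hLsurj, hLcost⟩ := exists_reassignment (x := x) (y := y) (c := -z)
    (g := fun t => -z - x t) (S := SL) (T := Finset.Icc i (l - 1))
    (Finset.filter_subset _ (Finset.Icc 1 (l - 1))) (by rw [Nat.card_Icc]; omega)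
    (by
      intro s hs hsT t ht
      have hs' := (Finset.mem_filter.1 hs).1
      rw [Finset.mem_Icc] at hs' hsT ht
      have := hmono s t (by omega) (by omega) (by omega)
      linarith)
    (by
      intro s hs
      have hs' := Finset.mem_filter.1 hs
      rw [Finset.mem_Icc] at hs'
      have h1 := hleft s (by omega) (by omega)
      rw [abs_of_nonpos (by linarith), abs_of_nonpos (by linarith)]
      ring)
  obtain ⟨eR, hRsurj, hRcost⟩ := exists_reassignment (x := x) (y := y) (c := β + z)
    (g := fun t => x t - z - β) (S := SR) (T := Finset.Icc (r + 1) j)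
    (Finset.filter_subset _ (Finset.Icc (r + 1) n)) (by rw [Nat.card_Icc]; omega)
    (by
      intro s hs hsT t ht
      have hs' := (Finset.mem_filter.1 hs).1
      rw [Finset.mem_Icc] at hs' hsT ht
      have := hmono t s (by omega) (by omega) (by omega)
      linarith)
    (by
      intro s hs
      have hs' := Finset.mem_filter.1 hs
      rw [Finset.mem_Icc] at hs'
      have h1 := hright s (by omega) (by omega)
      rw [abs_of_nonneg (by linarith), abs_of_nonneg (by linarith)]
      ring)
  let w : ℕ → ℝ := fun t => if t < l then y (eL t) else if t ≤ r then y t else y (eR t)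
  have hwL : ∀ t ∈ Finset.Icc i (l - 1), w t = y (eL t) := fun t ht => by
    rw [Finset.mem_Icc] at ht
    exact if_pos (by omega)
  have hwM : ∀ t ∈ Finset.Icc l r, w t = y t := fun t ht => by
    rw [Finset.mem_Icc] at ht
    simp only [w]
    rw [if_neg (by omega), if_pos (by omega)]
  have hwR : ∀ t ∈ Finset.Icc (r + 1) j, w t = y (eR t) := fun t ht => by
    rw [Finset.mem_Icc] at ht
    simp only [w]
    rw [if_neg (by omega), if_neg (by omega)]
  have hcov : Set.Icc (0 : ℝ) β ⊆ ⋃ t ∈ Finset.Icc i j, Set.Icc (w t - z) (w t + z) := by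
    intro p hp
    have hp' := hy hp
    simp only [Set.mem_iUnion, exists_prop] at hp' ⊢
    obtain ⟨s, hs, hps⟩ := hp'
    rw [Finset.mem_Icc] at hs
    have h1 := hp.1
    have h2 := hp.2
    have h3 := hps.1
    have h4 := hps.2
    rcases lt_or_ge s l with hsl | hsl
    · obtain ⟨t, ht, rfl⟩ := hLsurj s
        (Finset.mem_filter.2 ⟨Finset.mem_Icc.2 (by omega), by linarith⟩)
      exact ⟨t, Finset.Icc_subset_Icc le_rfl (by omega) ht, by rwa [hwL t ht]⟩
    rcases le_or_gt s r with hsr | hsr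
    · have ht : s ∈ Finset.Icc l r := Finset.mem_Icc.2 ⟨hsl, hsr⟩
      exact ⟨s, Finset.Icc_subset_Icc hil hrj ht, by rwa [hwM s ht]⟩
    · obtain ⟨t, ht, rfl⟩ := hRsurj s
        (Finset.mem_filter.2 ⟨Finset.mem_Icc.2 (by omega), by linarith⟩)
      exact ⟨t, Finset.Icc_subset_Icc (by omega) le_rfl ht, by rwa [hwR t ht]⟩
  refine ⟨i, j, by omega, hil, hrj, by omega, ?_, ?_⟩
  · have h := le_card_mul_of_cover hz hcov
    rw [Nat.card_Icc, show j + 1 - i = j - i + 1 by omega] at h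
    exact Nat.ceil_le.2 ((div_le_iff₀ (by positivity)).2 h)
  · have hopt := OptCG_le (x := x) (l := l) (r := r) hcov
    rw [sum_XMod_split z β x w hl hil hlr hrj,
      Finset.sum_congr rfl fun t ht => by rw [hwL t ht],
      Finset.sum_congr (s₁ := Finset.Icc l r) rfl fun t ht => by rw [hwM t ht],
      Finset.sum_congr (s₁ := Finset.Icc (r + 1) j) rfl fun t ht => by rw [hwR t ht]] at hopt
    rw [DG, Cost, sum_Icc_split _ hl hl hlr hrn]
    linarith

/-- Lemma 9: in the general case, the optimal cost decomposes over the leftmost and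
rightmost sensors used: `OptCost = min { D(i,j) : 1 ≤ i ≤ l, r ≤ j ≤ n, j − i + 1 ≥ λ }`
where `λ = ⌈β/(2z)⌉`. -/
theorem general_opt_eq_min_D
    (n : ℕ) (z β : ℝ) (x : ℕ → ℝ) (l r : ℕ)
    (hn : 1 ≤ n) (hz : 0 < z) (hβ : 0 < β)
    (hsort : ∀ i, 1 ≤ i → i < n → x i ≤ x (i + 1))
    (hfeas : β ≤ 2 * z * n)
    (hl1 : 1 < l) (hrn : r < n) (hlr : l ≤ r)
    (hlmem : -z ≤ x l ∧ x l ≤ β + z)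
    (hlmin : ∀ i, 1 ≤ i → i ≤ n → -z ≤ x i → x i ≤ β + z → l ≤ i)
    (hrmem : -z ≤ x r ∧ x r ≤ β + z)
    (hrmax : ∀ i, 1 ≤ i → i ≤ n → -z ≤ x i → x i ≤ β + z → i ≤ r) :
    OptCost n z β x =
      sInf {d : ℝ | ∃ i j : ℕ, 1 ≤ i ∧ i ≤ l ∧ r ≤ j ∧ j ≤ n ∧
        ⌈β / (2 * z)⌉₊ ≤ j - i + 1 ∧ d = DG z β x l r i j} := by
  have hmono : ∀ a b, 1 ≤ a → a ≤ b → b ≤ n → x a ≤ x b := by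
    intro a b ha hab
    induction b, hab using Nat.le_induction with
    | base => exact fun _ => le_rfl
    | succ b hab ih =>
      exact fun hb => (ih (by omega)).trans (hsort b (by omega) (by omega))
  have hleft : ∀ t, 1 ≤ t → t < l → x t < -z := by
    intro t ht htl
    by_contra! h
    have := hlmin t ht (by omega) h ((hmono t l ht htl.le (by omega)).trans hlmem.2)
    omega
  have hright : ∀ t, r < t → t ≤ n → β + z < x t := by
    intro t hrt ht
    by_contra! h
    have := hrmax t (by omega) ht (hrmem.1.trans (hmono r t (by omega) hrt.le ht)) h
    omega
  have hlen : ⌈β / (2 * z)⌉₊ ≤ n - 1 + 1 := by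
    rw [Nat.sub_add_cancel hn, Nat.ceil_le, div_le_iff₀ (by positivity)]
    linarith
  have hle : ∀ d ∈ {d : ℝ | ∃ i j : ℕ, 1 ≤ i ∧ i ≤ l ∧ r ≤ j ∧ j ≤ n ∧
      ⌈β / (2 * z)⌉₊ ≤ j - i + 1 ∧ d = DG z β x l r i j}, OptCost n z β x ≤ d := by
    rintro _ ⟨i, j, hi, hil, hrj, hjn, hij, rfl⟩
    exact OptCost_le_DG hz hl1.le hlr hleft hright hi hil hrj hjn hij
  refine le_antisymm (le_csInf ⟨_, 1, n, le_rfl, hl1.le, hrn.le, le_rfl, hlen, rfl⟩ hle) ?_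
  obtain ⟨y₀, hy₀⟩ := exists_cover hz hn hlen
  refine le_csInf ⟨_, y₀, hy₀, rfl⟩ ?_
  rintro _ ⟨y, hy, rfl⟩
  obtain ⟨i, j, hi, hil, hrj, hjn, hij, hD⟩ :=
    exists_DG_le_Cost hz hl1.le hlr hrn.le hmono hleft hright hy
  exact (csInf_le ⟨_, hle⟩ ⟨i, j, hi, hil, hrj, hjn, hij, rfl⟩).trans hD
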